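/- arXiv:2407.20374 — 2 statements merged into one kernel-verified Lean document; each statement's English description precedes it below -/
import Mathlib

section
/- Suppose n = 2^k·m with k ≥ 2 and m > 1 odd. Then for every positive integer N there exists an element γ ∈ Δ such that γ ≡ R^{n/4} mod 2O (entrywise congruence of matrices) and the (2,1)-entry (lower-left entry) of γ lies in the ideal N·O. (This is the key construction showing that the invariant δ mod 2^{k−1} of McMullen is not a congruence invariant for such n.) -/
open Matrix
open scoped MatrixGroups

set_option synthInstance.maxHeartbeats 1000000
set_option maxHeartbeats 1000000

noncomputable section

/-- The ring `O = ℤ[ζ + ζ⁻¹]`, realized as a subalgebra of `ℂ`. -/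
abbrev Oring (ζ : ℂ) : Subalgebra ℤ ℂ := Algebra.adjoin ℤ {ζ + ζ⁻¹}

/-- The element `ζ + ζ⁻¹` of `O`. -/
def lamO (ζ : ℂ) : Oring ζ := ⟨ζ + ζ⁻¹, Algebra.subset_adjoin rfl⟩

/-- The matrix `T = [[1, 2 + ζ + ζ⁻¹], [0, 1]]` in `SL₂(O)`. -/
def Tmat (ζ : ℂ) : SL(2, Oring ζ) :=
  ⟨!![1, 2 + lamO ζ; 0, 1], by rw [Matrix.det_fin_two_of]; ring⟩

/-- The matrix `U = [[-1, 0], [1, -1]]` in `SL₂(O)`. -/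
def Umat (ζ : ℂ) : SL(2, Oring ζ) :=
  ⟨!![-1, 0; 1, -1], by rw [Matrix.det_fin_two_of]; ring⟩

/-- The matrix `R = U * T` in `SL₂(O)`. -/
def Rmat (ζ : ℂ) : SL(2, Oring ζ) := Umat ζ * Tmat ζ

/-- The triangle group `Δ = ⟨T, U⟩ ⊆ SL₂(O)`. -/
def Delta (ζ : ℂ) : Subgroup SL(2, Oring ζ) := Subgroup.closure {Tmat ζ, Umat ζ}

/-- Reduction mod the ideal `J`: the natural map `SL₂(O) → SL₂(O/J)`. -/
def SLred (ζ : ℂ) (J : Ideal (Oring ζ)) : SL(2, Oring ζ) →* SL(2, Oring ζ ⧸ J) :=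
  Matrix.SpecialLinearGroup.map (Ideal.Quotient.mk J)


namespace DeltaKey

section generic

variable {A : Type*} [CommRing A]

lemma val_mul (a b : SL(2, A)) : (a * b).1 = a.1 * b.1 := rfl

lemma val_inv (a : SL(2, A)) : (a⁻¹).1 = a.1.adjugate := rfl

lemma val_neg (a : SL(2, A)) : (-a).1 = -a.1 := rfl

/-- `P H q x y z`: some element of `H` is `1 + q X` with `X ≡ [[x,y],[z,x]]` mod `2`. -/
def P (H : Subgroup SL(2, A)) (q x y z : A) : Prop :=
  ∃ δ ∈ H, ∃ e1 e2 e3 e4 : A, (δ : Matrix (Fin 2) (Fin 2) A) =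
    !![1 + q * (x + 2 * e1), q * (y + 2 * e2); q * (z + 2 * e3), 1 + q * (x + 2 * e4)]

lemma P_congr {H : Subgroup SL(2, A)} {q x y z x' y' z' : A} (h : P H q x y z) (a b c : A)
    (hx : x = x' + 2 * a) (hy : y = y' + 2 * b) (hz : z = z' + 2 * c) : P H q x' y' z' := by
  obtain ⟨δ, hδ, e1, e2, e3, e4, h⟩ := h
  refine ⟨δ, hδ, a + e1, b + e2, c + e3, a + e4, ?_⟩
  rw [h, hx, hy, hz]
  congr 1
  ext i j; fin_cases i <;> fin_cases j <;> simp <;> ring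

lemma P_add {H : Subgroup SL(2, A)} {q r x y z x' y' z' : A} (hq : q = 2 * r)
    (h : P H q x y z) (h' : P H q x' y' z') : P H q (x + x') (y + y') (z + z') := by
  obtain ⟨δ, hδ, e1, e2, e3, e4, h⟩ := h
  obtain ⟨δ', hδ', f1, f2, f3, f4, h'⟩ := h'
  refine ⟨δ * δ', H.mul_mem hδ hδ',
    e1 + f1 + r * ((x + 2 * e1) * (x' + 2 * f1) + (y + 2 * e2) * (z' + 2 * f3)),
    e2 + f2 + r * ((x + 2 * e1) * (y' + 2 * f2) + (y + 2 * e2) * (x' + 2 * f4)),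
    e3 + f3 + r * ((z + 2 * e3) * (x' + 2 * f1) + (x + 2 * e4) * (z' + 2 * f3)),
    e4 + f4 + r * ((z + 2 * e3) * (y' + 2 * f2) + (x + 2 * e4) * (x' + 2 * f4)), ?_⟩
  rw [val_mul, h, h', Matrix.mul_fin_two, hq]
  ext i j; fin_cases i <;> fin_cases j <;> simp <;> ring

variable {μ : A} {T U : SL(2, A)}

lemma P_conjT {H : Subgroup SL(2, A)} {q x y z : A}
    (hT : (T : Matrix (Fin 2) (Fin 2) A) = !![1, μ; 0, 1]) (hTH : T ∈ H)
    (h : P H q x y z) : P H q (x + μ * z) (y - μ ^ 2 * z) z := by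
  obtain ⟨δ, hδ, e1, e2, e3, e4, h⟩ := h
  refine ⟨T * δ * T⁻¹, H.mul_mem (H.mul_mem hTH hδ) (H.inv_mem hTH),
    e1 + μ * e3, e2 + μ * (e4 - e1) - μ ^ 2 * e3, e3, e4 - μ * e3 - μ * z, ?_⟩
  rw [val_mul, val_mul, val_inv, h, hT,
    Matrix.adjugate_fin_two_of, Matrix.mul_fin_two, Matrix.mul_fin_two]
  ext i j; fin_cases i <;> fin_cases j <;> simp <;> ring

lemma P_conjU {H : Subgroup SL(2, A)} {q x y z : A}
    (hU : (U : Matrix (Fin 2) (Fin 2) A) = !![-1, 0; 1, -1]) (hUH : U ∈ H)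
    (h : P H q x y z) : P H q (x + y) y (z - y) := by
  obtain ⟨δ, hδ, e1, e2, e3, e4, h⟩ := h
  refine ⟨U * δ * U⁻¹, H.mul_mem (H.mul_mem hUH hδ) (H.inv_mem hUH),
    e1 + e2, e2, e3 - e1 + e4 - e2, e4 - e2 - y, ?_⟩
  rw [val_mul, val_mul, val_inv, h, hU,
    Matrix.adjugate_fin_two_of, Matrix.mul_fin_two, Matrix.mul_fin_two]
  ext i j; fin_cases i <;> fin_cases j <;> simp <;> ring

lemma T_pow (hT : (T : Matrix (Fin 2) (Fin 2) A) = !![1, μ; 0, 1]) (x : ℕ) :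
    ((T ^ x : SL(2, A)) : Matrix (Fin 2) (Fin 2) A) = !![1, x * μ; 0, 1] := by
  induction x with
  | zero => ext i j; fin_cases i <;> fin_cases j <;> simp
  | succ x ih =>
    rw [pow_succ, val_mul, ih, hT, Matrix.mul_fin_two]
    ext i j; fin_cases i <;> fin_cases j <;> simp <;> ring

lemma U_pow (hU : (U : Matrix (Fin 2) (Fin 2) A) = !![-1, 0; 1, -1]) (x : ℕ) :
    ((U ^ (2 * x) : SL(2, A)) : Matrix (Fin 2) (Fin 2) A) = !![1, 0; -(2 * x : A), 1] := by
  induction x with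
  | zero => ext i j; fin_cases i <;> fin_cases j <;> simp
  | succ x ih =>
    rw [mul_add, mul_one, pow_add, pow_two, val_mul, val_mul,
      ih, hU, Matrix.mul_fin_two, Matrix.mul_fin_two]
    ext i j; fin_cases i <;> fin_cases j <;> simp <;> ring

lemma exists_P {H : Subgroup SL(2, A)}
    (hT : (T : Matrix (Fin 2) (Fin 2) A) = !![1, μ; 0, 1]) (hTH : T ∈ H)
    (hU : (U : Matrix (Fin 2) (Fin 2) A) = !![-1, 0; 1, -1]) (hUH : U ∈ H)
    (lam : A) (hlam : μ = 2 + lam) (b : ℕ) (p : Polynomial ℤ) :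
    ∃ x y, P H (2 ^ (b + 1)) x y (Polynomial.aeval lam p) := by
  have hq : (2 : A) ^ (b + 1) = 2 * 2 ^ b := by ring
  set q : A := 2 ^ (b + 1) with hqdef
  have toZ : ∀ {x y z}, P H q x y z → P H q y 0 y := fun {x y z} h =>
    P_congr (P_add hq h (P_conjU hU hUH h)) x y (z - y) (by ring) (by ring) (by ring)
  have mulT : ∀ {x y z}, P H q x y z → P H q (μ * z) (μ ^ 2 * z) 0 := fun {x y z} h =>
    P_congr (P_add hq h (P_conjT hT hTH h)) x (y - μ ^ 2 * z) z (by ring) (by ring) (by ring)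
  have h1 : P H q 0 0 1 := by
    refine ⟨U ^ (2 * 2 ^ b), H.pow_mem hUH _, 0, 0, -1, 0, ?_⟩
    rw [U_pow hU, hq]
    ext i j; fin_cases i <;> fin_cases j <;> simp <;> ring
  have hmu : P H q 0 μ 0 := by
    refine ⟨T ^ (2 * 2 ^ b), H.pow_mem hTH _, 0, 0, 0, 0, ?_⟩
    rw [T_pow hT, hq]
    ext i j; fin_cases i <;> fin_cases j <;> simp
  let S : A → Prop := fun z => ∃ x y, P H q x y z
  have Sadd : ∀ {z z'}, S z → S z' → S (z + z') := by
    rintro z z' ⟨x, y, h⟩ ⟨x', y', h'⟩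
    exact ⟨_, _, P_add hq h h'⟩
  have Scongr : ∀ {z z'} (c : A), S z → z = z' + 2 * c → S z' := by
    rintro z z' c ⟨x, y, h⟩ hz
    exact ⟨x, y, P_congr h 0 0 c (by ring) (by ring) hz⟩
  have S0 : S 0 := ⟨0, 0, P_congr (P_add hq h1 h1) 0 0 1 (by ring) (by ring) (by ring)⟩
  have Smu2 : ∀ {z}, S z → S (μ ^ 2 * z) := by
    rintro z ⟨x, y, h⟩
    exact ⟨_, _, toZ (mulT h)⟩
  have key : ∀ k : ℕ, S (lam ^ k) ∧ S (μ * lam ^ k) := by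
    intro k
    induction k with
    | zero => exact ⟨⟨_, _, by simpa using h1⟩, ⟨_, _, by simpa using toZ hmu⟩⟩
    | succ k ih =>
      refine ⟨Scongr (lam ^ k) ih.2 (by rw [hlam]; ring), ?_⟩
      exact Scongr (μ * lam ^ k) (Smu2 ih.1) (by rw [hlam]; ring)
  have Snat : ∀ (z : A) (j : ℕ), S z → S (j * z) := by
    intro z j h
    induction j with
    | zero => simpa using S0
    | succ j ih => exact Scongr 0 (Sadd ih h) (by push_cast; ring)
  have Sint : ∀ (z : A) (j : ℤ), S z → S (j * z) := by
    intro z j h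
    obtain ⟨t, rfl | rfl⟩ := j.eq_nat_or_neg
    · simpa using Snat z t h
    · exact Scongr (t * z) (Snat z t h) (by push_cast; ring)
  change S _
  induction p using Polynomial.induction_on' with
  | add p q hp hq => rw [map_add]; exact Sadd hp hq
  | monomial k c =>
    rw [Polynomial.aeval_monomial]
    simpa using Sint _ c (key k).1

/-- The 2-adic approximation. -/
lemma two_adic {H : Subgroup SL(2, A)}
    (hT : (T : Matrix (Fin 2) (Fin 2) A) = !![1, μ; 0, 1]) (hTH : T ∈ H)
    (hU : (U : Matrix (Fin 2) (Fin 2) A) = !![-1, 0; 1, -1]) (hUH : U ∈ H)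
    (lam : A) (hlam : μ = 2 + lam)
    (hgen : ∀ a : A, ∃ p : Polynomial ℤ, Polynomial.aeval lam p = a)
    (g : SL(2, A)) (hg : g ∈ H) (hg2 : (2 : A) ∣ g.1 1 0) (b : ℕ) :
    ∃ h ∈ H, (∀ i j, (2 : A) ∣ h.1 i j - g.1 i j) ∧ (2 : A) ^ (b + 1) ∣ h.1 1 0 := by
  induction b with
  | zero => exact ⟨g, hg, by simp, by simpa using hg2⟩
  | succ b ih =>
    obtain ⟨h, hH, hcong, c, hc⟩ := ih
    have hdet := h.2
    rw [Matrix.det_fin_two] at hdet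
    obtain ⟨p, hp⟩ := hgen (-(h.1 0 0 * c))
    obtain ⟨x, y, δ, hδ, e1, e2, e3, e4, hδe⟩ := exists_P (H := H) hT hTH hU hUH lam hlam b p
    rw [hp] at hδe
    have d00 : δ.1 0 0 = 1 + 2 ^ (b + 1) * (x + 2 * e1) := by rw [hδe]; simp
    have d01 : δ.1 0 1 = 2 ^ (b + 1) * (y + 2 * e2) := by rw [hδe]; simp
    have d10 : δ.1 1 0 = 2 ^ (b + 1) * (-(h.1 0 0 * c) + 2 * e3) := by rw [hδe]; simp
    have d11 : δ.1 1 1 = 1 + 2 ^ (b + 1) * (x + 2 * e4) := by rw [hδe]; simp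
    have hmul : ∀ i j, (h * δ).1 i j = h.1 i 0 * δ.1 0 j + h.1 i 1 * δ.1 1 j := by
      intro i j
      change (h.1 * δ.1) i j = _
      rw [Matrix.mul_apply, Fin.sum_univ_two]
    refine ⟨h * δ, H.mul_mem hH hδ, ?_, ?_⟩
    · intro i j
      obtain ⟨r, hr⟩ := hcong i j
      have hj : j = 0 ∨ j = 1 := by fin_cases j <;> simp
      rcases hj with rfl | rfl
      · refine ⟨r + 2 ^ b * (h.1 i 0 * (x + 2 * e1) + h.1 i 1 * (-(h.1 0 0 * c) + 2 * e3)), ?_⟩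
        rw [hmul, d00, d10]
        linear_combination hr
      · refine ⟨r + 2 ^ b * (h.1 i 0 * (y + 2 * e2) + h.1 i 1 * (x + 2 * e4)), ?_⟩
        rw [hmul, d01, d11]
        linear_combination hr
    · refine ⟨2 ^ b * c * (x + 2 * e1) + h.1 1 1 * e3 - h.1 0 1 * c * 2 ^ b * c, ?_⟩
      rw [hmul, d00, d10]
      linear_combination (1 + 2 ^ (b + 1) * (x + 2 * e1) - 2 ^ (b + 1) * c * h.1 0 1) * hc
        - 2 ^ (b + 1) * c * hdet

lemma sl_map_ext {J : Ideal A} {a b : SL(2, A)} (h : ∀ i j, a.1 i j - b.1 i j ∈ J) :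
    SpecialLinearGroup.map (Ideal.Quotient.mk J) a =
      SpecialLinearGroup.map (Ideal.Quotient.mk J) b := by
  ext i j
  exact Ideal.Quotient.eq.mpr (h i j)

lemma sl_map_entry {J : Ideal A} {a b : SL(2, A)} (h :
    SpecialLinearGroup.map (Ideal.Quotient.mk J) a =
      SpecialLinearGroup.map (Ideal.Quotient.mk J) b) (i j) : a.1 i j - b.1 i j ∈ J := by
  apply Ideal.Quotient.eq.mp
  have := congrArg (fun s => s.1 i j) h
  exact this

/-- Independence of the odd part and the `2`-part. -/
lemma indep (hT : (T : Matrix (Fin 2) (Fin 2) A) = !![1, μ; 0, 1])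
    (hU : (U : Matrix (Fin 2) (Fin 2) A) = !![-1, 0; 1, -1])
    (a N' : ℕ) (hN' : Odd N') (h : SL(2, A)) (hh : h ∈ Subgroup.closure {T, U}) :
    ∃ ε ∈ Subgroup.closure {T, U},
      SpecialLinearGroup.map (Ideal.Quotient.mk (Ideal.span {(2 : A) ^ a})) ε = 1 ∧
      ∃ σ : SL(2, A), (σ = 1 ∨ σ = -1) ∧
      SpecialLinearGroup.map (Ideal.Quotient.mk (Ideal.span {(N' : A)})) ε =
      SpecialLinearGroup.map (Ideal.Quotient.mk (Ideal.span {(N' : A)})) (σ * h) := by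
  have hco : Nat.Coprime (2 ^ (a + 1)) N' := Nat.Coprime.pow_left _ hN'.coprime_two_left
  obtain ⟨x, hx0, hx1⟩ := Nat.chineseRemainder hco 0 1
  obtain ⟨t, ht⟩ := (Nat.modEq_zero_iff_dvd).mp hx0
  obtain ⟨s, hs⟩ := (Nat.modEq_iff_dvd.mp hx1.symm)
  have htA : (x : A) = 2 ^ (a + 1) * t := by rw [ht]; push_cast; ring
  have hsA : (x : A) - 1 = N' * s := by
    have := congrArg (fun z : ℤ => (z : A)) hs
    push_cast at this
    exact this
  have hx2 : x = 2 * (2 ^ a * t) := by rw [ht]; ring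
  have hTx := T_pow hT x
  have hUx : ((U ^ x : SL(2, A)) : Matrix (Fin 2) (Fin 2) A) = !![1, 0; -(x : A), 1] := by
    have := U_pow hU (2 ^ a * t)
    rw [← hx2] at this
    rw [this, hx2]; push_cast; rfl
  induction hh using Subgroup.closure_induction with
  | mem y hy =>
    rcases hy with rfl | rfl
    · refine ⟨y ^ x, Subgroup.pow_mem _ (Subgroup.subset_closure (by simp)) _, ?_, 1,
        Or.inl rfl, ?_⟩
      · rw [← map_one (SpecialLinearGroup.map (Ideal.Quotient.mk (Ideal.span {(2 : A) ^ a})))]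
        apply sl_map_ext
        intro i j
        rw [Ideal.mem_span_singleton, hTx, htA]
        fin_cases i <;> fin_cases j <;> simp
        exact ⟨2 * t * μ, by ring⟩
      · apply sl_map_ext
        intro i j
        rw [Ideal.mem_span_singleton, hTx, one_mul, hT]
        fin_cases i <;> fin_cases j <;> simp
        exact ⟨s * μ, by linear_combination μ * hsA⟩
    · refine ⟨y ^ x, Subgroup.pow_mem _ (Subgroup.subset_closure (by simp)) _, ?_, -1,
        Or.inr rfl, ?_⟩
      · rw [← map_one (SpecialLinearGroup.map (Ideal.Quotient.mk (Ideal.span {(2 : A) ^ a})))]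
        apply sl_map_ext
        intro i j
        rw [Ideal.mem_span_singleton, hUx, htA]
        fin_cases i <;> fin_cases j <;> simp
        exact ⟨2 * t, by ring⟩
      · apply sl_map_ext
        intro i j
        rw [Ideal.mem_span_singleton, hUx, neg_one_mul, val_neg, hU]
        fin_cases i <;> fin_cases j <;> simp
        exact ⟨-s, by linear_combination -hsA⟩
  | one => exact ⟨1, Subgroup.one_mem _, by simp, 1, Or.inl rfl, by simp⟩
  | mul y z _ _ hy hz =>
    obtain ⟨ε, hε, h1, σ, hσ, h2⟩ := hy
    obtain ⟨ε', hε', h1', σ', hσ', h2'⟩ := hz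
    refine ⟨ε * ε', Subgroup.mul_mem _ hε hε', by rw [map_mul, h1, h1', one_mul], σ * σ', ?_, ?_⟩
    · rcases hσ with rfl | rfl <;> rcases hσ' with rfl | rfl <;> simp
    · rw [map_mul, h2, h2', ← map_mul]
      congr 1
      rcases hσ with rfl | rfl <;> rcases hσ' with rfl | rfl <;> simp
  | inv y _ hy =>
    obtain ⟨ε, hε, h1, σ, hσ, h2⟩ := hy
    refine ⟨ε⁻¹, Subgroup.inv_mem _ hε, by rw [map_inv, h1, inv_one], σ, hσ, ?_⟩
    rw [map_inv, h2, ← map_inv]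
    congr 1
    rcases hσ with rfl | rfl
    · simp
    · rw [_root_.mul_inv_rev, neg_one_mul]
      have : (-1 : SL(2, A))⁻¹ = -1 := inv_eq_of_mul_eq_one_left (by simp)
      rw [this]; simp

/-- Generic version of the theorem. -/
lemma generic (hT : (T : Matrix (Fin 2) (Fin 2) A) = !![1, μ; 0, 1])
    (hU : (U : Matrix (Fin 2) (Fin 2) A) = !![-1, 0; 1, -1])
    (lam : A) (hlam : μ = 2 + lam)
    (hgen : ∀ a : A, ∃ p : Polynomial ℤ, Polynomial.aeval lam p = a)
    (g : SL(2, A)) (hg : g ∈ Subgroup.closure {T, U}) (hg2 : (2 : A) ∣ g.1 1 0)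
    (N : ℕ) (hN : 0 < N) :
    ∃ γ ∈ Subgroup.closure {T, U},
      SpecialLinearGroup.map (Ideal.Quotient.mk (Ideal.span {(2 : A)})) γ =
      SpecialLinearGroup.map (Ideal.Quotient.mk (Ideal.span {(2 : A)})) g ∧
      γ.1 1 0 ∈ Ideal.span {(N : A)} := by
  obtain ⟨a, N', hodd, rfl⟩ := Nat.exists_eq_two_pow_mul_odd hN.ne'
  obtain ⟨h, hH, hcong, hdiv⟩ := two_adic (H := Subgroup.closure {T, U}) hT
    (Subgroup.subset_closure (by simp)) hU (Subgroup.subset_closure (by simp)) lam hlam hgen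
    g hg hg2 a
  obtain ⟨ε, hε, h1, σ, hσ, h2⟩ := indep hT hU (a + 1) N' hodd h⁻¹ (Subgroup.inv_mem _ hH)
  have h1e := fun i j => Ideal.mem_span_singleton.mp (sl_map_entry (h1.trans (map_one _).symm) i j)
  have hmul : ∀ i j, (h * ε).1 i j = h.1 i 0 * ε.1 0 j + h.1 i 1 * ε.1 1 j := by
    intro i j
    change (h.1 * ε.1) i j = _
    rw [Matrix.mul_apply, Fin.sum_univ_two]
  refine ⟨h * ε, Subgroup.mul_mem _ hH hε, ?_, ?_⟩
  · have e1 : SpecialLinearGroup.map (Ideal.Quotient.mk (Ideal.span {(2 : A)})) ε = 1 := by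
      rw [← map_one (SpecialLinearGroup.map (Ideal.Quotient.mk (Ideal.span {(2 : A)})))]
      apply sl_map_ext
      intro i j
      rw [Ideal.mem_span_singleton]
      exact (dvd_pow_self 2 (Nat.succ_ne_zero a)).trans (h1e i j)
    rw [map_mul, e1, mul_one]
    exact sl_map_ext fun i j => Ideal.mem_span_singleton.mpr (hcong i j)
  · rw [Ideal.mem_span_singleton]
    push_cast
    apply IsCoprime.mul_dvd
    · have hco : IsCoprime ((2 ^ a : ℕ) : ℤ) (N' : ℤ) :=
        Nat.isCoprime_iff_coprime.mpr (Nat.Coprime.pow_left _ hodd.coprime_two_left)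
      have := hco.map (Int.castRingHom A)
      simpa using this
    · rw [hmul]
      have hle : (2 : A) ^ a ∣ 2 ^ (a + 1) := pow_dvd_pow _ (Nat.le_succ a)
      have := h1e 1 0
      have h10 : (1 : SL(2, A)).1 1 0 = 0 := rfl
      rw [h10, sub_zero] at this
      exact dvd_add (Dvd.dvd.mul_right (hle.trans hdiv) _)
        (Dvd.dvd.mul_left (hle.trans this) _)
    · have h3 : SpecialLinearGroup.map (Ideal.Quotient.mk (Ideal.span {(N' : A)})) (h * ε) =
          SpecialLinearGroup.map (Ideal.Quotient.mk (Ideal.span {(N' : A)})) σ := by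
        rw [map_mul, h2, ← map_mul]
        congr 1
        rcases hσ with rfl | rfl <;> simp
      have := Ideal.mem_span_singleton.mp (sl_map_entry h3 1 0)
      rcases hσ with rfl | rfl <;> simpa using this

end generic

/-- `1 - ω` divides `1` in any ring, where `ω ^ (2 ^ j * m) = 1` suitably. -/
lemma unit_of {B : Type*} [CommRing B] [IsDomain B] (ω : B) (l m : ℕ) (hm : Odd m) (hm1 : 1 < m)
    (hω : IsPrimitiveRoot ω (2 ^ (l + 1) * m)) : (1 - ω) ∣ 1 := by
  have hpos : 0 < 2 ^ (l + 1) * m := by positivity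
  have d2 : (1 - ω) ∣ 2 := by
    have hp : IsPrimitiveRoot (ω ^ (2 ^ l * m)) 2 := hω.pow hpos (by ring)
    have : ω ^ (2 ^ l * m) = -1 := hp.eq_neg_one_of_two_right
    have h := one_sub_dvd_one_sub_pow ω (2 ^ l * m)
    rw [this] at h
    convert h using 1; ring
  have dm : (1 - ω) ∣ (m : B) := by
    have hp : IsPrimitiveRoot (ω ^ (2 ^ (l + 1))) m := hω.pow hpos rfl
    have hs := hp.geom_sum_eq_zero hm1
    have : (m : B) = ∑ i ∈ Finset.range m, (1 - (ω ^ (2 ^ (l + 1))) ^ i) := by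
      rw [Finset.sum_sub_distrib, hs]; simp
    rw [this]
    apply Finset.dvd_sum
    intro i _
    rw [← pow_mul]
    exact one_sub_dvd_one_sub_pow ω _
  obtain ⟨t, rfl⟩ := hm
  have : (1 : B) = ((2 * t + 1 : ℕ) : B) - t * 2 := by push_cast; ring
  have h := dvd_sub dm (Dvd.dvd.mul_left d2 (t : B))
  rwa [← this] at h

lemma conj_Oring {ζ : ℂ} (hc : (starRingEnd ℂ) ζ = ζ⁻¹) (x : ℂ) (hx : x ∈ Oring ζ) :
    (starRingEnd ℂ) x = x := by
  induction hx using Algebra.adjoin_induction with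
  | mem y hy =>
    rw [Set.mem_singleton_iff.mp hy, map_add, map_inv₀, hc, inv_inv, add_comm]
  | algebraMap r => simp
  | add x y _ _ hx hy => rw [map_add, hx, hy]
  | mul x y _ _ hx hy => rw [map_mul, hx, hy]

lemma mem_split {ζ : ℂ} (h0 : ζ ≠ 0) (x : ℂ) (hx : x ∈ Algebra.adjoin ℤ {ζ}) :
    ∃ a ∈ Oring ζ, ∃ b ∈ Oring ζ, x = a + b * ζ := by
  have hl : ζ + ζ⁻¹ ∈ Oring ζ := Algebra.subset_adjoin rfl
  have hz : ζ ^ 2 = (ζ + ζ⁻¹) * ζ - 1 := by field_simp; ring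
  induction hx using Algebra.adjoin_induction with
  | mem y hy =>
    exact ⟨0, Subalgebra.zero_mem _, 1, Subalgebra.one_mem _, by
      rw [Set.mem_singleton_iff.mp hy]; ring⟩
  | algebraMap r => exact ⟨_, Subalgebra.algebraMap_mem _ r, 0, Subalgebra.zero_mem _, by ring⟩
  | add x y _ _ hx hy =>
    obtain ⟨a, ha, b, hb, rfl⟩ := hx
    obtain ⟨a', ha', b', hb', rfl⟩ := hy
    exact ⟨_, Subalgebra.add_mem _ ha ha', _, Subalgebra.add_mem _ hb hb', by ring⟩
  | mul x y _ _ hx hy =>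
    obtain ⟨a, ha, b, hb, rfl⟩ := hx
    obtain ⟨a', ha', b', hb', rfl⟩ := hy
    refine ⟨a * a' - b * b', Subalgebra.sub_mem _ (Subalgebra.mul_mem _ ha ha')
      (Subalgebra.mul_mem _ hb hb'), a * b' + a' * b + b * b' * (ζ + ζ⁻¹),
      Subalgebra.add_mem _ (Subalgebra.add_mem _ (Subalgebra.mul_mem _ ha hb')
      (Subalgebra.mul_mem _ ha' hb)) (Subalgebra.mul_mem _ (Subalgebra.mul_mem _ hb hb') hl), ?_⟩
    linear_combination (b * b') * hz

lemma real_mem {ζ : ℂ} (h0 : ζ ≠ 0) (hc : (starRingEnd ℂ) ζ = ζ⁻¹) (hne : ζ⁻¹ ≠ ζ)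
    (x : ℂ) (hx : x ∈ Algebra.adjoin ℤ {ζ}) (hr : (starRingEnd ℂ) x = x) : x ∈ Oring ζ := by
  obtain ⟨a, ha, b, hb, rfl⟩ := mem_split h0 x hx
  rw [map_add, map_mul, conj_Oring hc a ha, conj_Oring hc b hb, hc] at hr
  have : b * (ζ⁻¹ - ζ) = 0 := by linear_combination hr
  have hb0 : b = 0 := (mul_eq_zero.mp this).resolve_right (sub_ne_zero.mpr hne)
  rw [hb0]; simpa using ha

lemma R_pow {ζ : ℂ} (h0 : ζ ≠ 0) (j : ℕ) :
    (((Rmat ζ ^ j).1 1 0 : Oring ζ) : ℂ) * (ζ - ζ⁻¹) = ζ ^ j - ζ⁻¹ ^ j ∧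
    (((Rmat ζ ^ j).1 1 1 : Oring ζ) : ℂ) * (ζ - ζ⁻¹) =
      (1 + ζ) * ζ ^ j - (1 + ζ⁻¹) * ζ⁻¹ ^ j := by
  have hz : ζ * ζ⁻¹ = 1 := mul_inv_cancel₀ h0
  induction j with
  | zero => simp
  | succ j ih =>
    have hR : (Rmat ζ).1 = !![-1, -(2 + lamO ζ); 1, 1 + lamO ζ] := by
      change (Umat ζ).1 * (Tmat ζ).1 = _
      rw [Umat, Tmat, Matrix.mul_fin_two]
      have h3 : (1 : Oring ζ) * (2 + lamO ζ) + -1 * 1 = 1 + lamO ζ := by ring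
      rw [h3]
      simp
    have hm : ∀ i, (Rmat ζ ^ (j + 1)).1 1 i =
        (Rmat ζ ^ j).1 1 0 * (Rmat ζ).1 0 i + (Rmat ζ ^ j).1 1 1 * (Rmat ζ).1 1 i := by
      intro i
      rw [pow_succ]
      change ((Rmat ζ ^ j).1 * (Rmat ζ).1) 1 i = _
      rw [Matrix.mul_apply, Fin.sum_univ_two]
    have hl : ((lamO ζ : Oring ζ) : ℂ) = ζ + ζ⁻¹ := rfl
    have e0 : (((Rmat ζ ^ (j + 1)).1 1 0 : Oring ζ) : ℂ) =
        -((Rmat ζ ^ j).1 1 0 : Oring ζ) + ((Rmat ζ ^ j).1 1 1 : Oring ζ) := by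
      rw [hm, hR]; simp
    have e1 : (((Rmat ζ ^ (j + 1)).1 1 1 : Oring ζ) : ℂ) =
        -((Rmat ζ ^ j).1 1 0 : Oring ζ) * (2 + (ζ + ζ⁻¹)) +
          ((Rmat ζ ^ j).1 1 1 : Oring ζ) * (1 + (ζ + ζ⁻¹)) := by
      rw [hm, hR]
      have h2 : ((2 : Oring ζ) : ℂ) = 2 := rfl
      simp [hl, h2]
      ring
    rw [e0, e1]
    obtain ⟨i0, i1⟩ := ih
    constructor
    · linear_combination i1 - i0
    · linear_combination (1 + (ζ + ζ⁻¹)) * i1 - (2 + (ζ + ζ⁻¹)) * i0 +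
        (ζ ^ j - ζ⁻¹ ^ j) * hz

end DeltaKey

theorem delta_invariant_not_congruence_key_construction
    (n k m : ℕ) (hk : 2 ≤ k) (hm1 : 1 < m) (hmodd : Odd m) (hn : n = 2 ^ k * m)
    (ζ : ℂ) (hζ : IsPrimitiveRoot ζ n)
    (N : ℕ) (hN : 0 < N) :
    ∃ γ ∈ Delta ζ,
      SLred ζ (Ideal.span {(2 : Oring ζ)}) γ =
        SLred ζ (Ideal.span {(2 : Oring ζ)}) (Rmat ζ ^ (n / 4)) ∧
      (γ : Matrix (Fin 2) (Fin 2) (Oring ζ)) 1 0 ∈ Ideal.span {(N : Oring ζ)} := by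
  obtain ⟨l, rfl⟩ := Nat.exists_eq_add_of_le hk
  have hn4 : n = 4 * (2 ^ l * m) := by rw [hn]; ring
  have hj : n / 4 = 2 ^ l * m := by omega
  set j := 2 ^ l * m with hjdef
  have hnpos : 0 < n := by rw [hn]; positivity
  have h0 : ζ ≠ 0 := hζ.ne_zero hnpos.ne'
  have hz : ζ * ζ⁻¹ = 1 := mul_inv_cancel₀ h0
  have hc : (starRingEnd ℂ) ζ = ζ⁻¹ :=
    (Complex.inv_eq_conj (hζ.norm'_eq_one hnpos.ne')).symm
  have hω : IsPrimitiveRoot (ζ ^ 2) (2 ^ (l + 1) * m) := hζ.pow hnpos (by rw [hn]; ring)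
  have hi : ζ ^ j * ζ ^ j = -1 := by
    have : IsPrimitiveRoot (ζ ^ (2 * j)) 2 := hζ.pow hnpos (by rw [hn4]; ring)
    rw [← this.eq_neg_one_of_two_right]; ring
  have hne1 : ζ ^ 2 ≠ 1 := hω.ne_one (by
    have : 1 ≤ 2 ^ (l + 1) := Nat.one_le_two_pow
    nlinarith)
  have hne : ζ⁻¹ ≠ ζ := by
    intro h
    apply hne1
    rw [pow_two]; nth_rewrite 2 [← h]; exact hz
  -- the unit
  let Z : Subalgebra ℤ ℂ := Algebra.adjoin ℤ {ζ}
  let zz : Z := ⟨ζ, Algebra.subset_adjoin rfl⟩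
  have hωZ : IsPrimitiveRoot (zz ^ 2) (2 ^ (l + 1) * m) := by
    apply IsPrimitiveRoot.of_map_of_injective (f := Z.val) _ Subtype.val_injective
    exact hω
  obtain ⟨v, hv⟩ := DeltaKey.unit_of (zz ^ 2) l m hmodd hm1 hωZ
  have hvC : (1 : ℂ) = (1 - ζ ^ 2) * v := congrArg (fun t : Z => (t : ℂ)) hv
  have hinv : ζ⁻¹ ^ j = - ζ ^ j := by
    rw [inv_pow]; apply inv_eq_of_mul_eq_one_left; rw [neg_mul, hi, neg_neg]
  let w : ℂ := ζ ^ j * (-(ζ * v))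
  have hw : w * (ζ - ζ⁻¹) = ζ ^ j := by
    linear_combination (ζ ^ j * (v : ℂ)) * hz - ζ ^ j * hvC
  have hsub : ζ - ζ⁻¹ ≠ 0 := sub_ne_zero.mpr hne.symm
  have hwZ : w ∈ Z := ((zz ^ j * (-(zz * v)) : Z)).2
  have hwr : (starRingEnd ℂ) w = w := by
    have := congrArg (starRingEnd ℂ) hw
    rw [map_mul, map_sub, map_inv₀, map_pow, hc, inv_inv, hinv] at this
    apply mul_right_cancel₀ hsub
    linear_combination -this - hw
  have hwO := DeltaKey.real_mem h0 hc hne w hwZ hwr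
  have hc2 : (2 : Oring ζ) ∣ (Rmat ζ ^ (n / 4)).1 1 0 := by
    refine ⟨⟨w, hwO⟩, ?_⟩
    apply Subtype.ext
    change _ = 2 * w
    apply mul_right_cancel₀ hsub
    rw [hj, (DeltaKey.R_pow h0 j).1, hinv]
    linear_combination -2 * hw
  have hTm : Tmat ζ ∈ Delta ζ := Subgroup.subset_closure (by simp)
  have hUm : Umat ζ ∈ Delta ζ := Subgroup.subset_closure (by simp)
  have hgen : ∀ a : Oring ζ, ∃ p : Polynomial ℤ, Polynomial.aeval (lamO ζ) p = a := by
    rintro ⟨a, ha⟩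
    have ha' := ha
    rw [Oring, Algebra.adjoin_singleton_eq_range_aeval] at ha'
    obtain ⟨p, hp⟩ := ha'
    refine ⟨p, Subtype.ext ?_⟩
    refine Eq.trans ?_ hp
    exact (Polynomial.aeval_algHom_apply (Oring ζ).val (lamO ζ) p).symm
  exact DeltaKey.generic (T := Tmat ζ) (U := Umat ζ) (μ := 2 + lamO ζ) rfl rfl (lamO ζ) rfl hgen
    (Rmat ζ ^ (n / 4)) (Subgroup.pow_mem _ (Subgroup.mul_mem _ hUm hTm) _) hc2 N hN

end
end

section
/- Suppose n = 2m where m is odd and has at least two distinct prime factors. Then for every positive integer N there exists an element γ ∈ Δ whose (1,1)-entry (upper-left entry) lies in the ideal N·O. (This is the key construction showing that the invariant κ of McMullen is not a congruence invariant for such n.) -/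
open Matrix
open scoped MatrixGroups

set_option synthInstance.maxHeartbeats 1000000
set_option maxHeartbeats 1000000

noncomputable section

/-! ### Abstract part, over a commutative ring `A` -/

section abstract_part

variable {A : Type*} [CommRing A]

theorem kc_inv_entries (g : SL(2, A)) :
    (g⁻¹) 0 0 = g 1 1 ∧ (g⁻¹) 0 1 = - g 0 1 ∧ (g⁻¹) 1 0 = - g 1 0 ∧ (g⁻¹) 1 1 = g 0 0 := by
  rw [Matrix.SpecialLinearGroup.SL2_inv_expl]
  simp

theorem kc_mul_entries (g h : SL(2, A)) :
    (g * h) 0 0 = g 0 0 * h 0 0 + g 0 1 * h 1 0 ∧ (g * h) 0 1 = g 0 0 * h 0 1 + g 0 1 * h 1 1 ∧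
    (g * h) 1 0 = g 1 0 * h 0 0 + g 1 1 * h 1 0 ∧ (g * h) 1 1 = g 1 0 * h 0 1 + g 1 1 * h 1 1 := by
  simp [Matrix.mul_apply, Fin.sum_univ_two]

theorem kc_det (g : SL(2, A)) : g 0 0 * g 1 1 - g 0 1 * g 1 0 = 1 := by
  have := g.2
  rwa [Matrix.det_fin_two] at this

/-- upper unipotent -/
def kcT (u : A) : SL(2, A) := ⟨!![1, u; 0, 1], by simp⟩

/-- lower unipotent -/
def kcL (x : A) : SL(2, A) := ⟨!![1, 0; x, 1], by simp⟩

theorem kcT_e (x : A) : kcT x 0 0 = 1 ∧ kcT x 0 1 = x ∧ kcT x 1 0 = 0 ∧ kcT x 1 1 = 1 := by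
  simp [kcT]

theorem kcL_e (x : A) : kcL x 0 0 = 1 ∧ kcL x 0 1 = 0 ∧ kcL x 1 0 = x ∧ kcL x 1 1 = 1 := by
  simp [kcL]

theorem kcT_add (u v : A) : kcT (u + v) = kcT u * kcT v := by
  ext i j; fin_cases i <;> fin_cases j <;> simp [kcT_e, Matrix.mul_apply, Fin.sum_univ_two, add_comm]

theorem kcL_add (u v : A) : kcL (u + v) = kcL u * kcL v := by
  ext i j; fin_cases i <;> fin_cases j <;> simp [kcL_e, Matrix.mul_apply, Fin.sum_univ_two, add_comm]

theorem kcT_zero : kcT (0 : A) = 1 := by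
  ext i j; fin_cases i <;> fin_cases j <;> simp [kcT]

theorem kcL_zero : kcL (0 : A) = 1 := by
  ext i j; fin_cases i <;> fin_cases j <;> simp [kcL]

theorem kcL_neg (x : A) : kcL (-x) = (kcL x)⁻¹ := by
  rw [eq_inv_iff_mul_eq_one, ← kcL_add]; simp [kcL_zero]

theorem kcT_pow (u : A) (k : ℕ) : kcT u ^ k = kcT (k * u) := by
  induction k with
  | zero => simp [kcT_zero]
  | succ k ih => rw [pow_succ, ih, ← kcT_add]; congr 1; push_cast; ring

/-- The additive subgroup of `z` such that some `g ∈ G` is `1 + N X` with `X₁₂ ≡ z`. -/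
def kcStep (G : Subgroup SL(2, A)) (N : A) : AddSubgroup A where
  carrier := {z | ∃ g ∈ G, ∃ a b c d : A, g 0 0 = 1 + N * a ∧ g 0 1 = N * (z + N * b) ∧
    g 1 0 = N * c ∧ g 1 1 = 1 + N * d}
  zero_mem' := ⟨1, G.one_mem, 0, 0, 0, 0, by simp⟩
  add_mem' := by
    rintro z w ⟨g, hg, a, b, c, d, h1, h2, h3, h4⟩ ⟨g', hg', a', b', c', d', h1', h2', h3', h4'⟩
    obtain ⟨e1, e2, e3, e4⟩ := kc_mul_entries g g'
    refine ⟨g * g', G.mul_mem hg hg', a + a' + N * a * a' + (z + N * b) * (N * c'),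
      b + b' + a * (w + N * b') + (z + N * b) * d', c + c' + c * N * a' + N * d * c',
      d + d' + N * c * (w + N * b') + N * d * d', ?_, ?_, ?_, ?_⟩
    · rw [e1, h1, h2, h1', h3']; ring
    · rw [e2, h1, h2, h2', h4']; ring
    · rw [e3, h3, h4, h1', h3']; ring
    · rw [e4, h3, h4, h2', h4']; ring
  neg_mem' := by
    rintro z ⟨g, hg, a, b, c, d, h1, h2, h3, h4⟩
    obtain ⟨e1, e2, e3, e4⟩ := kc_inv_entries g
    refine ⟨g⁻¹, G.inv_mem hg, d, -b, -c, a, ?_, ?_, ?_, ?_⟩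
    · rw [e1, h4]
    · rw [e2, h2]; ring
    · rw [e3, h3]; ring
    · rw [e4, h1]

theorem kc_step (G : Subgroup SL(2, A)) (u : A) (hT : kcT u ∈ G)
    (hspan : ∀ S : AddSubgroup A, (∀ g ∈ G, u * g 0 0 ^ 2 ∈ S) → ∀ x, x ∈ S)
    (N : ℕ) (γ : SL(2, A)) (hγ : γ ∈ G) (hN : (N : A) ∣ γ 0 0) :
    ∃ γ' ∈ G, ((N ^ 2 : ℕ) : A) ∣ γ' 0 0 := by
  obtain ⟨α, hα⟩ := hN
  have key := hspan (kcStep G (N : A)) (by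
    intro g hg
    refine ⟨g * kcT u ^ N * g⁻¹, G.mul_mem (G.mul_mem hg (G.pow_mem hT N)) (G.inv_mem hg),
      - u * g 0 0 * g 1 0, 0, - u * g 1 0 ^ 2, u * g 0 0 * g 1 0, ?_⟩
    rw [kcT_pow]
    obtain ⟨e1, e2, e3, e4⟩ := kc_mul_entries (g * kcT ((N : A) * u)) g⁻¹
    obtain ⟨f1, f2, f3, f4⟩ := kc_mul_entries g (kcT ((N : A) * u))
    obtain ⟨i1, i2, i3, i4⟩ := kc_inv_entries g
    have hd := kc_det g
    have t1 : (kcT ((N : A) * u)) 0 0 = 1 := by simp [kcT]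
    have t2 : (kcT ((N : A) * u)) 0 1 = N * u := by simp [kcT]
    have t3 : (kcT ((N : A) * u)) 1 0 = 0 := by simp [kcT]
    have t4 : (kcT ((N : A) * u)) 1 1 = 1 := by simp [kcT]
    rw [e1, e2, e3, e4, f1, f2, f3, f4, i1, i2, i3, i4, t1, t2, t3, t4]
    refine ⟨?_, ?_, ?_, ?_⟩
    · linear_combination hd
    · ring
    · ring
    · linear_combination hd)
  obtain ⟨g, hg, a, b, c, d, h1, h2, h3, h4⟩ := key (α * γ 0 1)
  obtain ⟨e1, -, -, -⟩ := kc_mul_entries g γ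
  have hd := kc_det γ
  refine ⟨g * γ, G.mul_mem hg hγ, a * α + b * γ 1 0 + α * α * γ 1 1, ?_⟩
  rw [e1, h1, h2]
  push_cast
  linear_combination (1 + N * a + N * α * γ 1 1) * hα - N * α * hd

theorem kc_pow (G : Subgroup SL(2, A)) (u : A) (hT : kcT u ∈ G)
    (hspan : ∀ S : AddSubgroup A, (∀ g ∈ G, u * g 0 0 ^ 2 ∈ S) → ∀ x, x ∈ S)
    (N : ℕ) (h : ∃ γ ∈ G, (N : A) ∣ γ 0 0) (k : ℕ) :
    ∃ γ' ∈ G, ((N ^ 2 ^ k : ℕ) : A) ∣ γ' 0 0 := by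
  induction k with
  | zero => simpa using h
  | succ k ih =>
    obtain ⟨γ, hγ, hd⟩ := ih
    obtain ⟨γ', h1, h2⟩ := kc_step G u hT hspan _ γ hγ hd
    refine ⟨γ', h1, ?_⟩
    rwa [← pow_mul, ← pow_succ] at h2

/-- The additive subgroup of `x` such that `G` contains an element trivial modulo `2` and
lower unipotent with entry `x` modulo `M`. -/
def kcLow (G : Subgroup SL(2, A)) (I J : Ideal A) : AddSubgroup A where
  carrier := {x | ∃ g ∈ G, Matrix.SpecialLinearGroup.map (Ideal.Quotient.mk I) g = 1 ∧
    Matrix.SpecialLinearGroup.map (Ideal.Quotient.mk J) g = kcL (Ideal.Quotient.mk J x)}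
  zero_mem' := ⟨1, G.one_mem, by simp, by simp [kcL_zero]⟩
  add_mem' := by
    rintro z w ⟨g, hg, h1, h2⟩ ⟨g', hg', h1', h2'⟩
    refine ⟨g * g', G.mul_mem hg hg', by rw [map_mul, h1, h1', one_mul], ?_⟩
    rw [map_mul, h2, h2', map_add, kcL_add]
  neg_mem' := by
    rintro z ⟨g, hg, h1, h2⟩
    refine ⟨g⁻¹, G.inv_mem hg, by rw [map_inv, h1, inv_one], ?_⟩
    rw [map_inv, h2, map_neg, kcL_neg]

theorem kc_low (G : Subgroup SL(2, A)) (u c : A) (hT : kcT u ∈ G) (hL : kcL (2 : A) ∈ G)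
    (hgen : ∀ S : AddSubgroup A, (∀ x ∈ S, u * x ∈ S) → ∀ r, ∀ x ∈ S, r * x ∈ S)
    (e : SL(2, A)) (he : e ∈ G) (e00 : e 0 0 = -2 * c) (e01 : e 0 1 = -u * c) (e10 : e 1 0 = c)
    (e11 : e 1 1 = (u - 2) * c) (j : ℕ) (x : A) :
    x ∈ kcLow G (Ideal.span {(2 : A)}) (Ideal.span {(2 * j + 1 : A)}) := by
  set I := Ideal.span {(2 : A)}
  set J := Ideal.span {(2 * j + 1 : A)}
  set H := kcLow G I J with hH
  have hc : c ^ 2 * (4 - u) = 1 := by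
    have := kc_det e
    rw [e00, e01, e10, e11] at this
    linear_combination this
  have h2 : (2 : A) ∈ H := by
    refine ⟨kcL 2, hL, ?_, ?_⟩
    · have : (Ideal.Quotient.mk I) 2 = 0 :=
        Ideal.Quotient.eq_zero_iff_mem.2 (Ideal.mem_span_singleton_self _)
      ext i j; fin_cases i <;> fin_cases j <;> simp [kcL_e]
      simpa using this
    · ext i j; fin_cases i <;> fin_cases j <;> simp [kcL_e]
  have hJ : ∀ x ∈ J, x ∈ H := by
    intro x hx
    refine ⟨1, G.one_mem, by simp, ?_⟩
    rw [Ideal.Quotient.eq_zero_iff_mem.2 hx, kcL_zero, map_one]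
  have hmul : ∀ x ∈ H, u * x ∈ H := by
    intro x hx
    have hx0 := hx
    obtain ⟨g, hg, h1, h2⟩ := hx
    obtain ⟨f1, f2, f3, f4⟩ := kc_mul_entries e (kcT ((j : A) * u))
    set D := e * kcT ((j : A) * u) with hD
    have hDG : D ∈ G := by
      rw [hD, ← kcT_pow]; exact G.mul_mem he (G.pow_mem hT j)
    have t1 : (kcT ((j : A) * u)) 0 0 = 1 := by simp [kcT]
    have t2 : (kcT ((j : A) * u)) 0 1 = j * u := by simp [kcT]
    have t3 : (kcT ((j : A) * u)) 1 0 = 0 := by simp [kcT]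
    have t4 : (kcT ((j : A) * u)) 1 1 = 1 := by simp [kcT]
    rw [e00, e01, t2, t4] at f2
    rw [e10, e11, t2, t4] at f4
    have d01 : D 0 1 ∈ J := by
      rw [f2]; exact Ideal.mem_span_singleton.2 ⟨-u * c, by ring⟩
    have hr : D 1 1 ^ 2 * x ∈ H := by
      refine ⟨D * g * D⁻¹, G.mul_mem (G.mul_mem hDG hg) (G.inv_mem hDG), ?_, ?_⟩
      · rw [map_mul, map_mul, map_inv, h1]; simp
      · rw [map_mul, map_mul, map_inv, h2, mul_inv_eq_iff_eq_mul]
        have d01' := Ideal.Quotient.eq_zero_iff_mem.2 d01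
        have hdet := congrArg (Ideal.Quotient.mk J) (kc_det D)
        simp only [map_sub, map_mul, map_one, d01'] at hdet
        ext a b
        fin_cases a <;> fin_cases b <;>
          simp [kcL_e, Matrix.mul_apply, Fin.sum_univ_two, d01']
        linear_combination (-(Ideal.Quotient.mk J) (D 1 1) * (Ideal.Quotient.mk J) x) * hdet
    have h4 : 4 * (D 1 1 ^ 2 * x) ∈ H := by
      have := H.nsmul_mem hr 4
      simpa using this
    have h5 : (4 - u) * x - 4 * (D 1 1 ^ 2 * x) ∈ H := by
      apply hJ
      rw [f4]
      refine Ideal.mem_span_singleton.2 ⟨- u * c ^ 2 * (u * (2 * j + 1) + 2 * (u - 4)) * x, ?_⟩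
      linear_combination (-(4 - u) * x) * hc
    have h6 := H.add_mem h5 h4
    have h7 : 4 * x ∈ H := by
      have := H.nsmul_mem hx0 4
      simpa using this
    have h8 := H.sub_mem h7 h6
    convert h8 using 1
    ring
  have hall := hgen H hmul
  have e1 : (x * (2 * j + 1)) ∈ H := hJ _ (Ideal.mul_mem_left _ _ (Ideal.mem_span_singleton_self _))
  have e2 := hall (x * j) 2 h2
  have := H.sub_mem e1 e2
  convert this using 1
  ring

theorem kc_base (G : Subgroup SL(2, A)) (u c v : A) (huv : u * v = 1)
    (hT : kcT u ∈ G) (hL : kcL (2 : A) ∈ G)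
    (hgen : ∀ S : AddSubgroup A, (∀ x ∈ S, u * x ∈ S) → ∀ r, ∀ x ∈ S, r * x ∈ S)
    (e : SL(2, A)) (he : e ∈ G) (e00 : e 0 0 = -2 * c) (e01 : e 0 1 = -u * c) (e10 : e 1 0 = c)
    (e11 : e 1 1 = (u - 2) * c) (j : ℕ) :
    ∃ γ ∈ G, ((2 * (2 * j + 1) : ℕ) : A) ∣ γ 0 0 := by
  obtain ⟨g, hg, h1, h2⟩ := kc_low G u c hT hL hgen e he e00 e01 e10 e11 j (-j * (1 - v))
  refine ⟨kcT u ^ 2 * (g * e), G.mul_mem (G.pow_mem hT 2) (G.mul_mem hg he), ?_⟩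
  rw [kcT_pow]
  obtain ⟨f1, -, -, -⟩ := kc_mul_entries (kcT (((2 : ℕ) : A) * u)) (g * e)
  obtain ⟨k1, -, k3, -⟩ := kc_mul_entries g e
  have t1 : (kcT (((2 : ℕ) : A) * u)) 0 0 = 1 := by simp [kcT]
  have t2 : (kcT (((2 : ℕ) : A) * u)) 0 1 = 2 * u := by simp [kcT]
  rw [f1, t1, t2, k1, k3, e00, e10]
  have m01 : (2 : A) ∣ g 0 1 := by
    have := congrArg (fun z : SL(2, A ⧸ Ideal.span {(2 : A)}) => z 0 1) h1
    simp at this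
    exact Ideal.mem_span_singleton.1 (Ideal.Quotient.eq_zero_iff_mem.1 this)
  have n00 : (2 * j + 1 : A) ∣ g 0 0 - 1 := by
    have := congrArg (fun z : SL(2, A ⧸ Ideal.span {(2 * j + 1 : A)}) => z 0 0) h2
    simp [kcL] at this
    exact Ideal.mem_span_singleton.1 (Ideal.Quotient.eq.1 (by simpa using this))
  have n01 : (2 * j + 1 : A) ∣ g 0 1 := by
    have := congrArg (fun z : SL(2, A ⧸ Ideal.span {(2 * j + 1 : A)}) => z 0 1) h2
    simp [kcL] at this
    exact Ideal.mem_span_singleton.1 (Ideal.Quotient.eq_zero_iff_mem.1 this)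
  have n10 : (2 * j + 1 : A) ∣ g 1 0 - (-j * (1 - v)) := by
    have := congrArg (fun z : SL(2, A ⧸ Ideal.span {(2 * j + 1 : A)}) => z 1 0) h2
    simp [kcL] at this
    exact Ideal.mem_span_singleton.1 (Ideal.Quotient.eq.1 (by simpa using this))
  have n11 : (2 * j + 1 : A) ∣ g 1 1 - 1 := by
    have := congrArg (fun z : SL(2, A ⧸ Ideal.span {(2 * j + 1 : A)}) => z 1 1) h2
    simp [kcL] at this
    exact Ideal.mem_span_singleton.1 (Ideal.Quotient.eq.1 (by simpa using this))
  obtain ⟨m, hm⟩ := m01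
  obtain ⟨a, ha⟩ := n00
  obtain ⟨b, hb⟩ := n01
  obtain ⟨p, hp⟩ := n10
  obtain ⟨d, hd⟩ := n11
  have hcop : IsCoprime (2 : A) (2 * j + 1 : A) := ⟨-j, 1, by ring⟩
  push_cast
  apply hcop.mul_dvd
  · exact ⟨g 0 0 * (-c) + m * c + u * (g 1 0 * (-2 * c) + g 1 1 * c), by rw [hm]; ring⟩
  · refine ⟨-2 * c * a + b * c + 2 * u * (-2 * c * p + d * c) + 2 * u * c * (1 - v), ?_⟩
    rw [hb, show g 0 0 = 1 + (2 * j + 1) * a by rw [← ha]; ring,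
      show g 1 1 = 1 + (2 * j + 1) * d by rw [← hd]; ring,
      show g 1 0 = (-j * (1 - v)) + (2 * j + 1) * p by rw [← hp]; ring]
    linear_combination (2 * c) * huv

theorem kc_main (G : Subgroup SL(2, A)) (u c v : A) (huv : u * v = 1)
    (hT : kcT u ∈ G) (hL : kcL (2 : A) ∈ G)
    (hgen : ∀ S : AddSubgroup A, (∀ x ∈ S, u * x ∈ S) → ∀ r, ∀ x ∈ S, r * x ∈ S)
    (hspan : ∀ S : AddSubgroup A, (∀ g ∈ G, u * g 0 0 ^ 2 ∈ S) → ∀ x, x ∈ S)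
    (e : SL(2, A)) (he : e ∈ G) (e00 : e 0 0 = -2 * c) (e01 : e 0 1 = -u * c) (e10 : e 1 0 = c)
    (e11 : e 1 1 = (u - 2) * c) (N : ℕ) (hN : 0 < N) :
    ∃ γ ∈ G, (N : A) ∣ γ 0 0 := by
  obtain ⟨s, M, ⟨j, rfl⟩, rfl⟩ := Nat.exists_eq_two_pow_mul_odd hN.ne'
  obtain ⟨γ, hγ, hd⟩ := kc_pow G u hT hspan _
    (kc_base G u c v huv hT hL hgen e he e00 e01 e10 e11 j) s
  refine ⟨γ, hγ, dvd_trans ?_ hd⟩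
  apply Nat.cast_dvd_cast
  rw [mul_pow]
  exact mul_dvd_mul (pow_dvd_pow _ Nat.lt_two_pow_self.le) (dvd_pow_self _ (by positivity))

end abstract_part

/-! ### Concrete part -/

section concrete_part

theorem kc_gen (ζ : ℂ) (S : AddSubgroup (Oring ζ)) (hS : ∀ x ∈ S, (2 + lamO ζ) * x ∈ S) :
    ∀ r, ∀ x ∈ S, r * x ∈ S := by
  rintro ⟨r, hr⟩
  induction hr using Algebra.adjoin_induction with
  | mem r hr =>
    intro x hx
    have hr' : r = ζ + ζ⁻¹ := hr
    subst hr'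
    have h1 := S.sub_mem (hS x hx) (S.nsmul_mem hx 2)
    convert h1 using 1
    change lamO ζ * x = _
    rw [nsmul_eq_mul]; push_cast; ring
  | algebraMap k =>
    intro x hx
    have h1 := S.zsmul_mem hx k
    convert h1 using 1
    rw [zsmul_eq_mul]
    rfl
  | add a b ha hb iha ihb =>
    intro x hx
    have h1 := S.add_mem (iha x hx) (ihb x hx)
    convert h1 using 1
    rw [← add_mul]
    rfl
  | mul a b ha hb iha ihb =>
    intro x hx
    have h1 := iha _ (ihb x hx)
    convert h1 using 1
    rw [← mul_assoc]
    rfl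

/-- The elements `η ^ j + η ^ (-j)` with `η = -ζ`. -/
def kcl (ζ : ℂ) : ℕ → Oring ζ
  | 0 => 2
  | 1 => -lamO ζ
  | (j + 2) => -lamO ζ * kcl ζ (j + 1) - kcl ζ j

theorem kcl_coe (ζ : ℂ) (h0 : ζ ≠ 0) : ∀ j : ℕ, ((kcl ζ j : Oring ζ) : ℂ) =
    (-ζ) ^ j + (-ζ)⁻¹ ^ j
  | 0 => by
    have h2 : ((2 : Oring ζ) : ℂ) = 2 := rfl
    simp only [kcl, h2]; norm_num
  | 1 => by simp [kcl, lamO]; ring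
  | (j + 2) => by
    have h1 := kcl_coe ζ h0 (j + 1)
    have h2 := kcl_coe ζ h0 j
    have h3 : (-ζ) * (-ζ)⁻¹ = 1 := mul_inv_cancel₀ (neg_ne_zero.2 h0)
    have h4 : ((lamO ζ : Oring ζ) : ℂ) = -(-ζ) - (-ζ)⁻¹ := by
      simp [lamO, inv_neg]
    simp only [kcl]
    push_cast
    rw [h1, h2, h4]
    linear_combination ((-ζ) ^ j + (-ζ)⁻¹ ^ j) * h3

theorem kcl_dvd (ζ : ℂ) : ∀ j : ℕ, (2 + lamO ζ) ∣ 2 - kcl ζ j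
  | 0 => by simp [kcl]
  | 1 => by simp [kcl]
  | (j + 2) => by
    obtain ⟨a, ha⟩ := kcl_dvd ζ (j + 1)
    obtain ⟨b, hb⟩ := kcl_dvd ζ j
    refine ⟨2 - lamO ζ * a - b, ?_⟩
    simp only [kcl]
    linear_combination (-lamO ζ) * ha - hb

theorem kc_geom (w : ℂ) (hw : w ≠ 0) (h : ℕ) :
    w ^ h * (1 + ∑ j ∈ Finset.range h, (w ^ (j + 1) + w⁻¹ ^ (j + 1))) =
      ∑ j ∈ Finset.range (2 * h + 1), w ^ j := by
  induction h with
  | zero => simp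
  | succ h ih =>
    rw [Finset.sum_range_succ, show 2 * (h + 1) + 1 = (2 * h + 1) + 1 + 1 by ring,
      Finset.sum_range_succ, Finset.sum_range_succ', Finset.sum_congr rfl
        (fun k _ => pow_succ w k), ← Finset.sum_mul, ← ih]
    have : w ^ (h + 1) * w⁻¹ ^ (h + 1) = 1 := by
      rw [← mul_pow, mul_inv_cancel₀ hw, one_pow]
    linear_combination this

/-- For a prime `2h+1` dividing `m`. -/
theorem kcl_sum (ζ : ℂ) (m h k : ℕ) (hm : m = (2 * h + 1) * k) (hh : 0 < h)
    (hm0 : 0 < m) (hη : IsPrimitiveRoot (-ζ) m) :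
    ∑ j ∈ Finset.range h, kcl ζ ((j + 1) * k) = -1 := by
  have h0 : -ζ ≠ 0 := hη.ne_zero hm0.ne'
  have h1 : IsPrimitiveRoot ((-ζ) ^ k) (2 * h + 1) := hη.pow hm0 (by rw [hm, mul_comm])
  have h2 := h1.geom_sum_eq_zero (by omega)
  have h3 := kc_geom ((-ζ) ^ k) (pow_ne_zero _ h0) h
  rw [h2] at h3
  have h4 := (mul_eq_zero.1 h3).resolve_left (pow_ne_zero _ (pow_ne_zero _ h0))
  apply Subtype.ext
  push_cast
  rw [Finset.sum_congr rfl (fun j _ => kcl_coe ζ (neg_ne_zero.1 h0) ((j + 1) * k))]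
  rw [eq_neg_iff_add_eq_zero, add_comm, ← h4]
  congr 1
  apply Finset.sum_congr rfl
  intro j _
  rw [inv_pow, inv_pow, ← pow_mul, mul_comm k]

theorem kc_dvd_prime (ζ : ℂ) (m p : ℕ) (hp : p.Prime) (hpm : p ∣ m) (hmodd : Odd m)
    (hη : IsPrimitiveRoot (-ζ) m) : (2 + lamO ζ) ∣ (p : Oring ζ) := by
  obtain ⟨k, hk⟩ := hpm
  have hpo : Odd p := by
    rw [hk] at hmodd; exact (Nat.odd_mul.1 hmodd).1
  obtain ⟨h, rfl⟩ := hpo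
  have hh : 0 < h := by
    rcases Nat.eq_zero_or_pos h with rfl | h'
    · exact absurd hp (by norm_num)
    · exact h'
  have hs := kcl_sum ζ m h k hk hh hmodd.pos hη
  have : ((2 * h + 1 : ℕ) : Oring ζ) = ∑ j ∈ Finset.range h, (2 - kcl ζ ((j + 1) * k)) := by
    rw [Finset.sum_sub_distrib, hs]
    simp
    ring
  rw [this]
  exact Finset.dvd_sum (fun j _ => kcl_dvd ζ _)

theorem kc_unit (ζ : ℂ) (m : ℕ) (hmodd : Odd m) (hη : IsPrimitiveRoot (-ζ) m)
    (hpq : ∃ p q : ℕ, p.Prime ∧ q.Prime ∧ p ≠ q ∧ p ∣ m ∧ q ∣ m) :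
    ∃ v, (2 + lamO ζ) * v = 1 := by
  obtain ⟨p, q, hp, hq, hne, hpm, hqm⟩ := hpq
  obtain ⟨a, ha⟩ := kc_dvd_prime ζ m p hp hpm hmodd hη
  obtain ⟨b, hb⟩ := kc_dvd_prime ζ m q hq hqm hmodd hη
  have hcop := Nat.isCoprime_iff_coprime.2 ((Nat.coprime_primes hp hq).2 hne)
  obtain ⟨x, y, hxy⟩ := hcop
  refine ⟨x * a + y * b, ?_⟩
  have := congrArg (Int.cast : ℤ → Oring ζ) hxy
  push_cast at this
  linear_combination this - x * ha - y * hb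

theorem kc_Rentries (ζ : ℂ) : (Rmat ζ) 0 0 = -1 ∧ (Rmat ζ) 0 1 = -(2 + lamO ζ) ∧
    (Rmat ζ) 1 0 = 1 ∧ (Rmat ζ) 1 1 = 1 + lamO ζ := by
  obtain ⟨e1, e2, e3, e4⟩ := kc_mul_entries (Umat ζ) (Tmat ζ)
  rw [Rmat, e1, e2, e3, e4]
  refine ⟨?_, ?_, ?_, ?_⟩ <;> simp [Umat, Tmat]
  ring

theorem kc_Rpow (ζ : ℂ) (i : ℕ) :
    (Rmat ζ ^ i) 0 1 = -(2 + lamO ζ) * (Rmat ζ ^ i) 1 0 ∧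
    (Rmat ζ ^ i) 1 1 = (Rmat ζ ^ i) 0 0 + (2 + lamO ζ) * (Rmat ζ ^ i) 1 0 := by
  induction i with
  | zero => simp
  | succ i ih =>
    obtain ⟨r1, r2, r3, r4⟩ := kc_Rentries ζ
    obtain ⟨e1, e2, e3, e4⟩ := kc_mul_entries (Rmat ζ) (Rmat ζ ^ i)
    rw [pow_succ', e1, e2, e3, e4, r1, r2, r3, r4, ih.1, ih.2]
    constructor <;> ring

theorem kc_Rpow_coe (ζ : ℂ) (h0 : ζ ≠ 0) (i : ℕ) :
    (((Rmat ζ ^ i) 0 0 : Oring ζ) : ℂ) * (ζ - 1) = ζ * ζ⁻¹ ^ i - ζ ^ i ∧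
    (((Rmat ζ ^ i) 1 0 : Oring ζ) : ℂ) * (ζ - ζ⁻¹) = ζ ^ i - ζ⁻¹ ^ i := by
  induction i with
  | zero => simp
  | succ i ih =>
    obtain ⟨r1, r2, r3, r4⟩ := kc_Rentries ζ
    obtain ⟨e1, -, e3, -⟩ := kc_mul_entries (Rmat ζ) (Rmat ζ ^ i)
    obtain ⟨h1, h2⟩ := ih
    have hz : ζ * ζ⁻¹ = 1 := mul_inv_cancel₀ h0
    rw [pow_succ', e1, e3, r1, r2, r3, r4]
    have hl : ((lamO ζ : Oring ζ) : ℂ) = ζ + ζ⁻¹ := rfl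
    have h2c : ((2 : Oring ζ) : ℂ) = 2 := rfl
    push_cast
    rw [hl, h2c]
    clear hl e1 e3 r1 r2 r3 r4 h2c
    generalize (((Rmat ζ ^ i) 0 0 : Oring ζ) : ℂ) = X at *
    generalize (((Rmat ζ ^ i) 1 0 : Oring ζ) : ℂ) = Y at *
    generalize ζ⁻¹ = w at *
    constructor
    · rw [pow_succ, pow_succ]
      generalize ζ ^ i = P at *
      generalize w ^ i = Q at *
      linear_combination (-1) * h1 - (ζ + 1) * h2 + (-2 * Y - Q) * hz
    · rw [pow_succ, pow_succ]
      generalize ζ ^ i = P at *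
      generalize w ^ i = Q at *
      linear_combination (1 + w) * h1 + (1 + ζ + w) * h2 + (-X + Q) * hz

theorem kc_T (ζ : ℂ) : kcT (2 + lamO ζ) ∈ Delta ζ := by
  have : kcT (2 + lamO ζ) = Tmat ζ := rfl
  rw [this]
  exact Subgroup.subset_closure (by simp)

theorem kc_U (ζ : ℂ) : Umat ζ ∈ Delta ζ := Subgroup.subset_closure (by simp)

theorem kc_L (ζ : ℂ) : kcL (2 : Oring ζ) ∈ Delta ζ := by
  have : kcL (2 : Oring ζ) = (Umat ζ * Umat ζ)⁻¹ := by
    rw [eq_inv_iff_mul_eq_one]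
    have u1 : (Umat ζ) 0 0 = -1 := by simp [Umat]
    have u2 : (Umat ζ) 0 1 = 0 := by simp [Umat]
    have u3 : (Umat ζ) 1 0 = 1 := by simp [Umat]
    have u4 : (Umat ζ) 1 1 = -1 := by simp [Umat]
    ext i j
    fin_cases i <;> fin_cases j <;>
      simp [kcL_e, Matrix.mul_apply, Fin.sum_univ_two, u1, u2, u3, u4]
    have h2c : ((2 : Oring ζ) : ℂ) = 2 := rfl
    rw [h2c]; norm_num
  rw [this]
  exact Subgroup.inv_mem _ (Subgroup.mul_mem _ (kc_U ζ) (kc_U ζ))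

theorem kc_R (ζ : ℂ) (i : ℕ) : Rmat ζ ^ i ∈ Delta ζ :=
  Subgroup.pow_mem _ (Subgroup.mul_mem _ (kc_U ζ) (kc_T ζ)) i

theorem kc_sq (ζ : ℂ) (h0 : ζ ≠ 0) (h1 : ζ ≠ 1) (t : ℕ) (hm : ζ ^ (2 * t + 1) = -1) (j : ℕ) :
    (4 - (2 + lamO ζ)) * (Rmat ζ ^ ((j + 1) * (t + 1))) 0 0 ^ 2 = 2 + kcl ζ j := by
  obtain ⟨hx, -⟩ := kc_Rpow_coe ζ h0 ((j + 1) * (t + 1))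
  have h2c : ((2 : Oring ζ) : ℂ) = 2 := rfl
  have h4c : ((4 : Oring ζ) : ℂ) = 4 := rfl
  have hl : ((lamO ζ : Oring ζ) : ℂ) = ζ + ζ⁻¹ := rfl
  apply Subtype.ext
  push_cast
  rw [kcl_coe ζ h0, h2c, h4c, hl]
  have hz2 : (ζ ^ ((j + 1) * (t + 1))) ^ 2 = (-ζ) ^ j * (-ζ) := by
    rw [← pow_mul, show (j + 1) * (t + 1) * 2 = (2 * t + 1 + 1) * (j + 1) by ring, pow_mul,
      pow_succ ζ (2 * t + 1), hm, neg_one_mul, pow_succ]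
  have hz0 : ζ ^ ((j + 1) * (t + 1)) ≠ 0 := pow_ne_zero _ h0
  have hj0 : (-ζ) ^ j ≠ 0 := pow_ne_zero _ (neg_ne_zero.2 h0)
  rw [inv_pow] at hx ⊢
  have h1' : ζ - 1 ≠ 0 := sub_ne_zero.2 h1
  generalize ((((Rmat ζ ^ ((j + 1) * (t + 1))) 0 0 : Oring ζ)) : ℂ) = X at *
  generalize ζ ^ ((j + 1) * (t + 1)) = z at *
  generalize (-ζ) ^ j = y at *
  have hw : ζ * ζ⁻¹ = 1 := mul_inv_cancel₀ h0
  have e : (4 - (2 + (ζ + ζ⁻¹))) * X ^ 2 = -(ζ⁻¹ * (X * (ζ - 1)) ^ 2) := by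
    field_simp
    ring
  rw [e, hx]
  have hzz : z⁻¹ ^ 2 = -(y⁻¹ * ζ⁻¹) := by
    rw [inv_pow, hz2, mul_inv, inv_neg]; ring
  have hzi : z * z⁻¹ = 1 := mul_inv_cancel₀ hz0
  generalize z⁻¹ = z' at *
  generalize ζ⁻¹ = w at *
  generalize y⁻¹ = y' at *
  linear_combination (-w * ζ ^ 2) * hzz + (-w) * hz2 + (2 * w * ζ) * hzi + (2 + y + y' * (w * ζ + 1)) * hw

theorem kc_span (ζ : ℂ) (h0 : ζ ≠ 0) (h1 : ζ ≠ 1) (t : ℕ) (hm : ζ ^ (2 * t + 1) = -1)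
    (hη : IsPrimitiveRoot (-ζ) (2 * t + 1)) (h k : ℕ) (hh : 0 < h)
    (hp : 2 * t + 1 = (2 * h + 1) * k) (c v : Oring ζ) (huv : (2 + lamO ζ) * v = 1)
    (hc : c ^ 2 * (4 - (2 + lamO ζ)) = 1) (S : AddSubgroup (Oring ζ))
    (hS : ∀ g ∈ Delta ζ, (2 + lamO ζ) * g 0 0 ^ 2 ∈ S) (x : Oring ζ) : x ∈ S := by
  set u := 2 + lamO ζ with hu
  let f : Oring ζ →+ Oring ζ := AddMonoidHom.mulLeft (u * c ^ 2)
  let C := AddSubgroup.closure (Set.range (fun j : ℕ => 2 + kcl ζ j))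
  have hC : C ≤ S.comap f := by
    rw [AddSubgroup.closure_le]
    rintro _ ⟨j, rfl⟩
    change u * c ^ 2 * (2 + kcl ζ j) ∈ S
    rw [← kc_sq ζ h0 h1 t hm j, ← hu]
    convert hS _ (kc_R ζ ((j + 1) * (t + 1))) using 1
    linear_combination (u * (Rmat ζ ^ ((j + 1) * (t + 1))) 0 0 ^ 2) * hc
  have hgenC : ∀ j, 2 + kcl ζ j ∈ C := fun j => AddSubgroup.subset_closure ⟨j, rfl⟩
  have hs := kcl_sum ζ _ h k hp hh (by omega) hη
  have hodd : (2 * h - 1 : Oring ζ) ∈ C := by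
    have h2 : ∑ j ∈ Finset.range h, (2 + kcl ζ ((j + 1) * k)) ∈ C :=
      AddSubgroup.sum_mem _ (fun j _ => hgenC _)
    rw [Finset.sum_add_distrib, hs] at h2
    convert h2 using 1
    simp
    ring
  have h4 : (4 : Oring ζ) ∈ C := by
    have := hgenC 0
    simp only [kcl] at this
    convert this using 1
    norm_num
  have hone : (1 : Oring ζ) ∈ C := by
    have a1 := C.zsmul_mem hodd (2 * h - 1)
    have a2 := C.zsmul_mem h4 (h ^ 2 - h)
    convert C.sub_mem a1 a2 using 1
    rw [zsmul_eq_mul, zsmul_eq_mul]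
    push_cast
    ring
  have hl : ∀ j, kcl ζ j ∈ C := by
    intro j
    convert C.sub_mem (hgenC j) (C.nsmul_mem hone 2) using 1
    simp
  have hmul : ∀ y ∈ C, u * y ∈ C := by
    intro y hy
    induction hy using AddSubgroup.closure_induction with
    | mem y hy =>
      obtain ⟨j, rfl⟩ := hy
      change u * (2 + kcl ζ j) ∈ C
      have hlam : lamO ζ ∈ C := by
        have := C.neg_mem (hl 1)
        simpa [kcl] using this
      have hlj : lamO ζ * kcl ζ j ∈ C := by
        cases j with
        | zero =>
          have := C.nsmul_mem hlam 2
          convert this using 1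
          simp [kcl]
          ring
        | succ j =>
          have := C.neg_mem (C.add_mem (hl (j + 2)) (hl j))
          convert this using 1
          simp only [kcl]
          ring
      have := C.add_mem (C.add_mem h4 (C.nsmul_mem (hl j) 2)) (C.add_mem (C.nsmul_mem hlam 2) hlj)
      convert this using 1
      rw [hu, nsmul_eq_mul, nsmul_eq_mul]
      push_cast
      ring
    | zero => simp
    | add a b _ _ ha hb => rw [mul_add]; exact C.add_mem ha hb
    | neg a _ ha => rw [mul_neg]; exact C.neg_mem ha
  have hall := kc_gen ζ C hmul
  have hfin := hC (hall ((4 - u) * v * x) 1 hone)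
  change u * c ^ 2 * ((4 - u) * v * x * 1) ∈ S at hfin
  convert hfin using 1
  linear_combination (-u * v * x) * hc - x * huv

end concrete_part


theorem kappa_invariant_not_congruence_key_construction
    (n m : ℕ) (hmodd : Odd m) (hn : n = 2 * m)
    (hpq : ∃ p q : ℕ, p.Prime ∧ q.Prime ∧ p ≠ q ∧ p ∣ m ∧ q ∣ m)
    (ζ : ℂ) (hζ : IsPrimitiveRoot ζ n)
    (N : ℕ) (hN : 0 < N) :
    ∃ γ ∈ Delta ζ,
      (γ : Matrix (Fin 2) (Fin 2) (Oring ζ)) 0 0 ∈ Ideal.span {(N : Oring ζ)} := by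
  have hm0 : 0 < m := hmodd.pos
  have hm1 : m ≠ 1 := by
    rintro rfl
    obtain ⟨p, q, hp, hq, hne, hpm, hqm⟩ := hpq
    exact hp.one_lt.ne' (Nat.dvd_one.1 hpm)
  have h0 : ζ ≠ 0 := hζ.ne_zero (by omega)
  have h1 : ζ ≠ 1 := hζ.ne_one (by omega)
  have hζm : ζ ^ m = -1 := by
    have h2 : IsPrimitiveRoot (ζ ^ m) 2 := hζ.pow (by omega) (by rw [hn, mul_comm])
    exact h2.eq_neg_one_of_two_right
  have hη : IsPrimitiveRoot (-ζ) m := by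
    have hz : -ζ = ζ ^ (m + 1) := by rw [pow_succ, hζm]; ring
    have h2 : IsPrimitiveRoot (ζ ^ 2) m := hζ.pow (by omega) hn
    obtain ⟨t, ht⟩ := hmodd
    rw [hz, show m + 1 = 2 * (t + 1) by omega, pow_mul]
    apply h2.pow_of_coprime
    rw [ht]
    have : Nat.Coprime (t + 1) (2 * (t + 1) - 1) := by
      have h3 : Nat.Coprime (2 * (t + 1)) (2 * (t + 1) - 1) := by
        have := Nat.coprime_self_add_left (m := 2 * t + 1) (n := 1)
        rw [show 2 * (t + 1) - 1 = 2 * t + 1 by omega, show 2 * (t + 1) = 2 * t + 1 + 1 by omega]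
        simp
      exact h3.coprime_mul_left
    rwa [show 2 * (t + 1) - 1 = 2 * t + 1 by omega] at this
  obtain ⟨v, huv⟩ := kc_unit ζ m hmodd hη hpq
  obtain ⟨p, q, hp, hq, hne, hpm, hqm⟩ := hpq
  obtain ⟨k, hk⟩ := hpm
  have hpo : Odd p := by
    have := hmodd
    rw [hk] at this; exact (Nat.odd_mul.1 this).1
  obtain ⟨h, rfl⟩ := hpo
  have hh : 0 < h := by
    rcases Nat.eq_zero_or_pos h with rfl | h'
    · exact absurd hp (by norm_num)
    · exact h'
  obtain ⟨t, rfl⟩ := hmodd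
  have hneg : ζ + 1 ≠ 0 := by
    intro hc
    have hc' : ζ ^ 2 = 1 := by
      rw [eq_neg_of_add_eq_zero_left hc]; ring
    have := Nat.le_of_dvd (by norm_num) (hζ.dvd_of_pow_eq_one 2 hc')
    omega
  have hent := kc_Rpow ζ (t + 1)
  set e := Rmat ζ ^ (t + 1) with he
  have e00 : e 0 0 = -2 * e 1 0 := by
    obtain ⟨hx, hy⟩ := kc_Rpow_coe ζ h0 (t + 1)
    rw [← he] at hx hy
    apply Subtype.ext
    have h2c : ((2 : Oring ζ) : ℂ) = 2 := rfl
    push_cast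
    rw [h2c]
    have hz2 : (ζ ^ (t + 1)) ^ 2 = -ζ := by
      rw [← pow_mul, show (t + 1) * 2 = 2 * t + 1 + 1 by ring, pow_succ, hζm]; ring
    have hz0 : ζ ^ (t + 1) ≠ 0 := pow_ne_zero _ h0
    rw [inv_pow] at hx hy
    generalize ((e 0 0 : Oring ζ) : ℂ) = X at *
    generalize ((e 1 0 : Oring ζ) : ℂ) = Y at *
    generalize ζ ^ (t + 1) = z at *
    have hne : (ζ - 1) * (ζ + 1) * z ≠ 0 := mul_ne_zero (mul_ne_zero (sub_ne_zero.2 h1) hneg) hz0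
    apply mul_left_cancel₀ hne
    field_simp at hx hy
    linear_combination (ζ + 1) * hx + 2 * hy + (ζ - 1) * hz2
  have e01 : e 0 1 = -(2 + lamO ζ) * e 1 0 := hent.1
  have e11 : e 1 1 = ((2 + lamO ζ) - 2) * e 1 0 := by rw [hent.2, e00]; ring
  have hc : (e 1 0) ^ 2 * (4 - (2 + lamO ζ)) = 1 := by
    have := kc_det e
    rw [e00, e01, e11] at this
    linear_combination this
  obtain ⟨γ, hγ, hd⟩ := kc_main (Delta ζ) (2 + lamO ζ) (e 1 0) v huv (kc_T ζ) (kc_L ζ)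
    (kc_gen ζ) (kc_span ζ h0 h1 t hζm hη h k hh hk (e 1 0) v huv hc) e (kc_R ζ _) e00 e01 rfl e11
    N hN
  exact ⟨γ, hγ, Ideal.mem_span_singleton.2 hd⟩

end
end
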